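/- For all positive integers n and k, and every colour-balanced edge-colouring c : E(K_{2nk}) → {1,…,k}, there exists a perfect matching M of K_{2nk} with f(M) ≤ 4^{k²}. -/

import Mathlib

/-- Conical version of Carathéodory's theorem. -/
theorem exists_linearIndepOn_conical_combination {ι E : Type*} [AddCommGroup E] [Module ℝ E]
    (v : ι → E) (s : Finset ι) (a : ι → ℝ) (ha : ∀ i ∈ s, 0 ≤ a i) :
    ∃ t ⊆ s, ∃ b : ι → ℝ, (∀ i ∈ t, 0 ≤ b i) ∧ LinearIndepOn ℝ v (t : Set ι) ∧
      ∑ i ∈ t, b i • v i = ∑ i ∈ s, a i • v i := by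
  classical
  induction s using Finset.strongInduction generalizing a with
  | H s ih =>
    by_cases hs : LinearIndepOn ℝ v (s : Set ι)
    · exact ⟨s, subset_rfl, a, ha, hs, rfl⟩
    obtain ⟨g, hg, i₀, hi₀, hpos⟩ : ∃ g : ι → ℝ, ∑ i ∈ s, g i • v i = 0 ∧ ∃ i ∈ s, 0 < g i := by
      rw [linearIndepOn_finset_iff] at hs
      push Not at hs
      obtain ⟨g, hg, i, hi, hne⟩ := hs
      rcases lt_or_gt_of_ne hne with h | h
      · exact ⟨-g, by simp [hg], i, hi, by simpa using h⟩
      · exact ⟨g, hg, i, hi, h⟩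
    obtain ⟨j, hj, hmin⟩ := (s.filter fun i => 0 < g i).exists_min_image (fun i => a i / g i)
      ⟨i₀, by simp [hi₀, hpos]⟩
    rw [Finset.mem_filter] at hj
    have hle : 0 ≤ a j / g j := div_nonneg (ha j hj.1) hj.2.le
    obtain ⟨t, hts, b, hb, hli, hsum⟩ := ih (s.erase j) (Finset.erase_ssubset hj.1)
      (fun i => a i - a j / g j * g i) (by
        intro i hi
        have his := Finset.mem_of_mem_erase hi
        rcases le_or_gt (g i) 0 with h | h
        · nlinarith [ha i his]
        · have := hmin i (by simp [his, h])
          rw [le_div_iff₀ h] at this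
          linarith)
    refine ⟨t, hts.trans (Finset.erase_subset _ _), b, hb, hli, hsum.trans ?_⟩
    have hz : a j - a j / g j * g j = 0 := by
      rw [div_mul_cancel₀ _ hj.2.ne', sub_self]
    rw [Finset.sum_erase _ (by rw [hz, zero_smul])]
    simp only [sub_smul, Finset.sum_sub_distrib, mul_smul, ← Finset.smul_sum, hg, smul_zero,
      sub_zero]

theorem abs_det_le_prod_sum_abs {κ : Type*} [Fintype κ] [DecidableEq κ] (A : Matrix κ κ ℝ) :
    |A.det| ≤ ∏ j, ∑ i, |A i j| := by
  rw [Matrix.det_apply]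
  refine (Finset.abs_sum_le_sum_abs _ _).trans ?_
  calc ∑ σ : Equiv.Perm κ, |Equiv.Perm.sign σ • ∏ i, A (σ i) i|
      = ∑ σ : Equiv.Perm κ, ∏ i, |A (σ i) i| := by
        refine Finset.sum_congr rfl fun σ _ => ?_
        rw [← Finset.abs_prod]
        rcases Int.units_eq_one_or (Equiv.Perm.sign σ) with h | h <;> simp [h]
    _ = ∑ f ∈ (Finset.univ : Finset (Equiv.Perm κ)).map
          ⟨fun σ : Equiv.Perm κ => (σ : κ → κ), DFunLike.coe_injective⟩, ∏ i, |A (f i) i| := by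
        rw [Finset.sum_map]; rfl
    _ ≤ ∑ f : κ → κ, ∏ i, |A (f i) i| :=
        Finset.sum_le_sum_of_subset_of_nonneg (Finset.subset_univ _)
          fun _ _ _ => Finset.prod_nonneg fun _ _ => abs_nonneg _
    _ = ∏ j, ∑ i, |A i j| := by
        rw [Finset.prod_univ_sum]
        simp

/-- Coefficients of a combination of linearly independent integer vectors of bounded length and
with vanishing coordinate sums are controlled by the combination. -/
theorem abs_coeff_le_of_linearIndepOn {ι κ : Type*} [Fintype κ] [DecidableEq κ] [Nonempty κ]
    (v : ι → κ → ℤ) (J : Finset ι) (b : ι → ℝ) {C : ℝ} (hC : 1 ≤ C)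
    (hv : ∀ p ∈ J, ∑ i, |(v p i : ℝ)| ≤ C) (hv0 : ∀ p ∈ J, ∑ i, v p i = 0)
    (hli : LinearIndepOn ℝ (fun p i => (v p i : ℝ)) (J : Set ι)) :
    J.card ≤ Fintype.card κ - 1 ∧ ∀ p ∈ J,
      |b p| ≤ C ^ (Fintype.card κ - 2) * ∑ i, |∑ q ∈ J, b q * (v q i : ℝ)| := by
  classical
  let gZ : ι ⊕ κ → κ → ℤ := Sum.elim v (fun i => Pi.single i 1)
  let g : ι ⊕ κ → κ → ℝ := fun x i => (gZ x i : ℝ)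
  have hli' : LinearIndepOn ℝ g (Sum.inl '' (J : Set ι)) :=
    LinearIndepOn.image_of_comp _ _ hli
  obtain ⟨B, hBt, hJB, hspan, hB⟩ := exists_linearIndepOn_extension hli'
    (t := Sum.inl '' (J : Set ι) ∪ Set.range Sum.inr) Set.subset_union_left
  have hBinl : ∀ p, Sum.inl p ∈ B → p ∈ J := by
    intro p hp
    simpa using hBt hp
  have hl1r : ∀ i₀, ∑ i, |g (Sum.inr i₀) i| = 1 := by
    intro i₀
    simp [g, gZ, Pi.single_apply, apply_ite]
  have hl1 : ∀ x ∈ B, ∑ i, |g x i| ≤ C := by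
    rintro (p | i₀) hx
    · exact hv p (hBinl p hx)
    · rw [hl1r]; exact hC
  have htop : Submodule.span ℝ (Set.range fun x : B => g x) = ⊤ := by
    rw [← Set.image_eq_range, eq_top_iff, ← (Pi.basisFun ℝ κ).span_eq, Submodule.span_le]
    rintro _ ⟨i, rfl⟩
    refine hspan ⟨Sum.inr i, by simp, ?_⟩
    ext l
    simp [g, gZ, Pi.single_apply]
  let bas : Module.Basis B ℝ (κ → ℝ) := Module.Basis.mk hB htop.ge
  let e : κ ≃ B := (Pi.basisFun ℝ κ).indexEquiv bas
  let A : Matrix κ κ ℝ := Matrix.of fun i j => g (e j) i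
  have hdet : A.det ≠ 0 := by
    have h : LinearIndependent ℝ A.col := hB.linearIndependent.comp e e.injective
    exact ((Matrix.isUnit_iff_isUnit_det A).mp
      (Matrix.linearIndependent_cols_iff_isUnit.mp h)).ne_zero
  have hdet1 : 1 ≤ |A.det| := by
    have : A.det = ((Matrix.of fun i j => gZ (e j) i : Matrix κ κ ℤ).det : ℝ) := by
      rw [Int.cast_det]
      rfl
    rw [this] at hdet ⊢
    exact_mod_cast Int.one_le_abs (by exact_mod_cast hdet)
  obtain ⟨j₀, i₀, hj₀⟩ : ∃ j₀ i₀, (e j₀ : ι ⊕ κ) = Sum.inr i₀ := by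
    by_contra! h
    apply hdet
    obtain ⟨k₀⟩ := ‹Nonempty κ›
    apply Matrix.exists_vecMul_eq_zero_iff.mp
    refine ⟨1, fun h1 => one_ne_zero (congrFun h1 k₀), ?_⟩
    ext j
    rw [Matrix.vecMul, one_dotProduct]
    rcases hj : (e j : ι ⊕ κ) with p | i
    · have := hv0 p (hBinl p (hj ▸ (e j).2))
      simp only [A, Matrix.of_apply, hj, g, gZ, Sum.elim_inl]
      rw [Pi.zero_apply]
      exact_mod_cast this
    · exact absurd hj (h j i)
  have hinl : ∀ p ∈ J, ∃ j, (e j : ι ⊕ κ) = Sum.inl p := fun p hp =>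
    ⟨e.symm ⟨Sum.inl p, hJB ⟨p, hp, rfl⟩⟩, by simp⟩
  refine ⟨?_, ?_⟩
  · choose! f hf using hinl
    rw [← Finset.card_univ, ← Finset.card_erase_of_mem (Finset.mem_univ j₀)]
    refine Finset.card_le_card_of_injOn f (fun p hp => ?_) fun p hp q hq hpq => ?_
    · simp only [Finset.coe_erase, Finset.coe_univ, Set.mem_sdiff, Set.mem_univ, true_and,
        Set.mem_singleton_iff]
      rintro rfl
      simp [hf p hp] at hj₀
    · have := hf p hp
      rw [hpq, hf q hq] at this
      exact (Sum.inl_injective this).symm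
  intro p hp
  let x : κ → ℝ := fun j => Sum.elim (fun q => b q) (fun _ => 0) (e j : ι ⊕ κ)
  have hx : A.mulVec x = fun i => ∑ q ∈ J, b q * (v q i : ℝ) := by
    ext i
    let F : ι ⊕ κ → ℝ := fun y => g y i * Sum.elim (fun q => b q) (fun _ => 0) y
    have h1 : A.mulVec x i = ∑ y : κ, F (e y) := rfl
    have h2 : ∑ y ∈ Finset.univ.map (e.toEmbedding.trans (Function.Embedding.subtype _)), F y
        = ∑ y ∈ J.map Function.Embedding.inl, F y := by
      refine (Finset.sum_subset ?_ ?_).symm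
      · intro y hy
        obtain ⟨q, hq, rfl⟩ := Finset.mem_map.mp hy
        obtain ⟨j, hj⟩ := hinl q hq
        exact Finset.mem_map.mpr ⟨j, by simp, hj⟩
      · intro y hy hy'
        obtain ⟨j, -, rfl⟩ := Finset.mem_map.mp hy
        rcases hj : (e j : ι ⊕ κ) with q | i
        · exact absurd (Finset.mem_map.mpr ⟨q, hBinl q (hj ▸ (e j).2), hj.symm⟩) hy'
        · simp [F, hj]
    rw [Finset.sum_map, Finset.sum_map] at h2
    rw [h1]
    refine h2.trans (Finset.sum_congr rfl fun q _ => ?_)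
    simp [F, g, gZ, mul_comm]
  obtain ⟨j, hj⟩ := hinl p hp
  have hxj : x j = b p := by simp [x, hj]
  have hcr : A.det * b p = (A.updateCol j (A.mulVec x)).det := by
    rw [← Matrix.cramer_apply, Matrix.cramer_eq_adjugate_mulVec, Matrix.mulVec_mulVec,
      Matrix.adjugate_mul, Matrix.smul_mulVec, Matrix.one_mulVec, Pi.smul_apply, hxj, smul_eq_mul]
  have hne : j₀ ≠ j := by
    rintro rfl
    simp [hj] at hj₀
  calc |b p| ≤ |A.det| * |b p| := le_mul_of_one_le_left (abs_nonneg _) hdet1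
    _ = |(A.updateCol j (A.mulVec x)).det| := by rw [← abs_mul, hcr]
    _ ≤ ∏ l, ∑ i, |A.updateCol j (A.mulVec x) i l| := abs_det_le_prod_sum_abs _
    _ = (∏ l ∈ (Finset.univ.erase j).erase j₀, ∑ i, |A i l|) * ∑ i, |A.mulVec x i| := by
      rw [← Finset.prod_erase_mul _ _ (Finset.mem_univ j),
        ← Finset.prod_erase_mul _ _ (Finset.mem_erase.mpr ⟨hne, Finset.mem_univ j₀⟩)]
      have h0 : ∑ i, |A.updateCol j (A.mulVec x) i j₀| = 1 := by
        simp only [Matrix.updateCol_ne hne, A, Matrix.of_apply, hj₀, hl1r]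
      rw [h0, mul_one]
      congr 1
      · refine Finset.prod_congr rfl fun l hl => ?_
        have : l ≠ j := by simp at hl; exact hl.2
        simp only [Matrix.updateCol_ne this]
      · simp only [Matrix.updateCol_self]
    _ ≤ C ^ (Fintype.card κ - 2) * ∑ i, |∑ q ∈ J, b q * (v q i : ℝ)| := by
      rw [hx]
      refine mul_le_mul_of_nonneg_right ?_ (Finset.sum_nonneg fun _ _ => abs_nonneg _)
      refine (Finset.prod_le_prod (fun l _ => Finset.sum_nonneg fun _ _ => abs_nonneg _)
        fun l _ => hl1 _ (e l).2).trans_eq ?_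
      rw [Finset.prod_const, Finset.card_erase_of_mem
        (Finset.mem_erase.mpr ⟨hne, Finset.mem_univ j₀⟩),
        Finset.card_erase_of_mem (Finset.mem_univ j), Finset.card_univ, Nat.sub_sub]

theorem exists_nat_combination_sum_abs_lt {ι κ : Type*} [Fintype κ] [DecidableEq κ]
    (v : ι → κ → ℤ) (s : Finset ι) (hv : ∀ p ∈ s, ∑ i, |(v p i : ℝ)| ≤ 4)
    (hv0 : ∀ p ∈ s, ∑ i, v p i = 0) (w : κ → ℤ) (a : ι → ℝ) (ha : ∀ p ∈ s, 0 ≤ a p) {E : ℝ}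
    (hE : ∑ i, |∑ p ∈ s, a p * (v p i : ℝ) + w i| ≤ E) {r m : ℕ} (hr : 0 < r)
    (hκ : Fintype.card κ = r + 1) (hm : m = 12 * r ^ 2 * 4 ^ (r - 1)) (hrE : 4 * (r : ℝ) ≤ E)
    (hw : 2 * E < ∑ i, |(w i : ℝ)|) :
    ∃ J ⊆ s, ∃ n : ι → ℕ, ∑ p ∈ J, n p ≤ m ∧
      ∑ i, |w i + ∑ p ∈ J, (n p : ℤ) * v p i| < ∑ i, |w i| := by
  have : Nonempty κ := Fintype.card_pos_iff.mp (by omega)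
  obtain ⟨J, hJ, b, hb, hli, hsum⟩ :=
    exists_linearIndepOn_conical_combination (fun p i => (v p i : ℝ)) s a ha
  have hsum' : ∀ i, ∑ p ∈ s, a p * (v p i : ℝ) = ∑ p ∈ J, b p * (v p i : ℝ) := by
    intro i
    simpa [Finset.sum_apply] using (congrFun hsum i).symm
  simp only [hsum'] at hE
  obtain ⟨hcard, hbound⟩ := abs_coeff_le_of_linearIndepOn v J b (C := 4) (by norm_num)
    (fun p hp => hv p (hJ hp)) (fun p hp => hv0 p (hJ hp)) hli
  rw [hκ] at hcard hbound
  have hexp : r + 1 - 2 = r - 1 := by omega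
  rw [hexp] at hbound
  simp only [add_tsub_cancel_right] at hcard
  set W : ℝ := ∑ i, |(w i : ℝ)| with hW
  set U : ℝ := ∑ i, |∑ p ∈ J, b p * (v p i : ℝ)| with hU
  set B : ℝ := ∑ p ∈ J, b p with hB
  have hcardR : (J.card : ℝ) ≤ r := by exact_mod_cast hcard
  have hU0 : 0 ≤ U := Finset.sum_nonneg fun _ _ => abs_nonneg _
  have hUW : U ≤ W + E := by
    calc U ≤ ∑ i, (|∑ p ∈ J, b p * (v p i : ℝ) + w i| + |(w i : ℝ)|) := by
          refine Finset.sum_le_sum fun i _ => ?_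
          simpa using abs_sub (∑ p ∈ J, b p * (v p i : ℝ) + w i) (w i : ℝ)
      _ ≤ W + E := by rw [Finset.sum_add_distrib]; linarith
  have hB0 : 0 ≤ B := Finset.sum_nonneg hb
  have hBU : B ≤ r * (4 ^ (r - 1) * U) := by
    calc B ≤ ∑ p ∈ J, 4 ^ (r - 1) * U :=
          Finset.sum_le_sum fun p hp => (le_abs_self _).trans (hbound p hp)
      _ = J.card * (4 ^ (r - 1) * U) := by rw [Finset.sum_const, nsmul_eq_mul]
      _ ≤ _ := by gcongr
  have hrR : (1 : ℝ) ≤ r := by exact_mod_cast hr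
  obtain ⟨μ, hμ0, hμ1, hμB, hμ⟩ : ∃ μ : ℝ, 0 ≤ μ ∧ μ ≤ 1 ∧ μ * B ≤ m ∧ 4 * r < μ * (W - E) := by
    rcases le_or_gt B m with h | h
    · exact ⟨1, zero_le_one, le_rfl, by simpa using h, by linarith⟩
    · have hBpos : 0 < B := lt_of_le_of_lt (Nat.cast_nonneg _) h
      refine ⟨m / B, by positivity, (div_le_one hBpos).mpr h.le,
        (div_mul_cancel₀ _ hBpos.ne').le, ?_⟩
      rw [div_mul_eq_mul_div, lt_div_iff₀ hBpos]
      have hP : (0 : ℝ) < 4 * r * (r * 4 ^ (r - 1)) := by positivity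
      calc 4 * r * B ≤ 4 * r * (r * (4 ^ (r - 1) * (W + E))) := by
            gcongr
            exact hBU.trans (by gcongr)
        _ = 4 * r * (r * 4 ^ (r - 1)) * (W + E) := by ring
        _ < 4 * r * (r * 4 ^ (r - 1)) * (3 * (W - E)) :=
            mul_lt_mul_of_pos_left (by linarith) hP
        _ = m * (W - E) := by rw [hm]; push_cast; ring
  have hfrac : ∀ p ∈ J, 0 ≤ μ * b p - ⌊μ * b p⌋₊ ∧ μ * b p - ⌊μ * b p⌋₊ ≤ 1 := by
    intro p hp
    have h1 := Nat.floor_le (mul_nonneg hμ0 (hb p hp))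
    have h2 := Nat.lt_floor_add_one (μ * b p)
    constructor <;> linarith
  refine ⟨J, hJ, fun p => ⌊μ * b p⌋₊, ?_, ?_⟩
  · have : ((∑ p ∈ J, ⌊μ * b p⌋₊ : ℕ) : ℝ) ≤ m := by
      push_cast
      refine le_trans (Finset.sum_le_sum fun p hp => ?_) ((Finset.mul_sum J b μ).symm.trans_le hμB)
      linarith [(hfrac p hp).1]
    exact_mod_cast this
  · have key : ∑ i, |(w i : ℝ) + ∑ p ∈ J, (⌊μ * b p⌋₊ : ℝ) * v p i| < W := by
      calc ∑ i, |(w i : ℝ) + ∑ p ∈ J, (⌊μ * b p⌋₊ : ℝ) * v p i|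
          ≤ ∑ i, ((1 - μ) * |(w i : ℝ)| + μ * |∑ p ∈ J, b p * (v p i : ℝ) + w i|
              + ∑ p ∈ J, |(v p i : ℝ)|) := by
            refine Finset.sum_le_sum fun i _ => ?_
            have h1 : (w i : ℝ) + ∑ p ∈ J, (⌊μ * b p⌋₊ : ℝ) * v p i
                = (1 - μ) * w i + μ * (∑ p ∈ J, b p * (v p i : ℝ) + w i)
                  - ∑ p ∈ J, (μ * b p - ⌊μ * b p⌋₊) * v p i := by
              simp only [sub_mul, Finset.sum_sub_distrib, mul_assoc, ← Finset.mul_sum]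
              ring
            rw [h1]
            refine (abs_sub _ _).trans (add_le_add ((abs_add_le _ _).trans_eq ?_) ?_)
            · rw [abs_mul, abs_mul, abs_of_nonneg hμ0, abs_of_nonneg (sub_nonneg.mpr hμ1)]
            · refine (Finset.abs_sum_le_sum_abs _ _).trans (Finset.sum_le_sum fun p hp => ?_)
              rw [abs_mul, abs_of_nonneg (hfrac p hp).1]
              exact mul_le_of_le_one_left (abs_nonneg _) (hfrac p hp).2
        _ = (1 - μ) * W + μ * ∑ i, |∑ p ∈ J, b p * (v p i : ℝ) + w i|
              + ∑ p ∈ J, ∑ i, |(v p i : ℝ)| := by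
            rw [Finset.sum_add_distrib, Finset.sum_add_distrib, Finset.mul_sum, Finset.mul_sum,
              Finset.sum_comm (s := J)]
        _ ≤ (1 - μ) * W + μ * E + 4 * r := by
            gcongr
            calc ∑ p ∈ J, ∑ i, |(v p i : ℝ)| ≤ ∑ p ∈ J, (4 : ℝ) :=
                  Finset.sum_le_sum fun p hp => hv p (hJ hp)
              _ = 4 * J.card := by rw [Finset.sum_const, nsmul_eq_mul, mul_comm]
              _ ≤ 4 * r := by gcongr
        _ < W := by linarith
    rw [hW] at key
    exact_mod_cast key

/-! ### Matchings as pairings of the vertex set -/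

section Pairing

variable {ι V κ : Type*}

/-- The edge with index `j` of the perfect matching given by a bijection `σ`. -/
def pairingEdge (σ : ι × Bool ≃ V) (j : ι) : Sym2 V := s(σ (j, false), σ (j, true))

/-- Exchange the second end of the edge `j` with the end `b` of the edge `l`. -/
def switchPairing [DecidableEq ι] (σ : ι × Bool ≃ V) (j l : ι) (b : Bool) : ι × Bool ≃ V :=
  (Equiv.swap (j, true) (l, b)).trans σ

theorem switchPairing_apply_of_ne [DecidableEq ι] (σ : ι × Bool ≃ V) {j l p : ι} (b b' : Bool)
    (hj : p ≠ j) (hl : p ≠ l) : switchPairing σ j l b (p, b') = σ (p, b') := by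
  simp [switchPairing, Equiv.swap_apply_of_ne_of_ne, hj, hl]

variable [DecidableEq κ] (c : Sym2 V → κ)

/-- The numbers of edges of each colour in the matching given by `σ`. -/
def colourCount [Fintype ι] (σ : ι × Bool ≃ V) (i : κ) : ℤ :=
  ∑ j, if c (pairingEdge σ j) = i then 1 else 0

/-- The change of the colour counts caused by `switchPairing σ j l b`. -/
def switchChange (σ : ι × Bool ≃ V) (j l : ι) (b : Bool) (i : κ) : ℤ :=
  (if c s(σ (j, false), σ (l, b)) = i then 1 else 0)
    + (if c s(σ (j, true), σ (l, !b)) = i then 1 else 0)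
    - (if c (pairingEdge σ j) = i then 1 else 0) - (if c (pairingEdge σ l) = i then 1 else 0)

theorem colourCount_switchPairing [Fintype ι] [DecidableEq ι] (σ : ι × Bool ≃ V) {j l : ι}
    (hjl : j ≠ l) (b : Bool) :
    colourCount c (switchPairing σ j l b) = colourCount c σ + switchChange c σ j l b := by
  ext i
  have hl : l ∈ Finset.univ.erase j := by simp [hjl.symm]
  have hj : j ∈ (Finset.univ : Finset ι) := Finset.mem_univ j
  have h1 : pairingEdge (switchPairing σ j l b) j = s(σ (j, false), σ (l, b)) := by
    simp [pairingEdge, switchPairing, Equiv.swap_apply_of_ne_of_ne, hjl]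
  have h2 : pairingEdge (switchPairing σ j l b) l = s(σ (j, true), σ (l, !b)) := by
    cases b <;>
    simp [pairingEdge, switchPairing, Equiv.swap_apply_of_ne_of_ne, hjl.symm, Sym2.eq_swap]
  have h3 : ∀ p ∈ (Finset.univ.erase j).erase l,
      pairingEdge (switchPairing σ j l b) p = pairingEdge σ p := by
    intro p hp
    simp only [Finset.mem_erase, Finset.mem_univ, and_true] at hp
    simp only [pairingEdge, switchPairing_apply_of_ne σ b _ hp.2 hp.1]
  simp only [colourCount, switchChange, Pi.add_apply]
  rw [← Finset.add_sum_erase _ _ hj, ← Finset.add_sum_erase _ _ hl,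
    ← Finset.add_sum_erase Finset.univ (fun p => if c (pairingEdge σ p) = i then (1 : ℤ) else 0) hj,
    ← Finset.add_sum_erase _ (fun p => if c (pairingEdge σ p) = i then (1 : ℤ) else 0) hl,
    h1, h2, Finset.sum_congr rfl fun p hp => by rw [h3 p hp]]
  ring

theorem sum_colourCount [Fintype ι] [Fintype κ] (σ : ι × Bool ≃ V) :
    ∑ i, colourCount c σ i = Fintype.card ι := by
  simp only [colourCount]
  rw [Finset.sum_comm]
  simp

theorem sum_switchChange [Fintype κ] (σ : ι × Bool ≃ V) (j l : ι) (b : Bool) :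
    ∑ i, switchChange c σ j l b i = 0 := by
  simp [switchChange, Finset.sum_add_distrib, Finset.sum_sub_distrib]

theorem sum_abs_switchChange_le [Fintype κ] (σ : ι × Bool ≃ V) (j l : ι) (b : Bool) :
    ∑ i, |switchChange c σ j l b i| ≤ 4 := by
  calc ∑ i, |switchChange c σ j l b i|
      ≤ ∑ i, ((if c s(σ (j, false), σ (l, b)) = i then 1 else 0)
        + (if c s(σ (j, true), σ (l, !b)) = i then 1 else 0)
        + (if c (pairingEdge σ j) = i then 1 else 0)
        + (if c (pairingEdge σ l) = i then (1 : ℤ) else 0)) := by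
        refine Finset.sum_le_sum fun i _ => ?_
        rw [switchChange]
        split_ifs <;> simp
    _ = 4 := by simp [Finset.sum_add_distrib]

theorem abs_switchChange_le_two (σ : ι × Bool ≃ V) (j l : ι) (b : Bool) (i : κ) :
    |switchChange c σ j l b i| ≤ 2 := by
  rw [switchChange]
  split_ifs <;> simp

/-- The finite set of all vectors that can occur as a change of the colour counts. -/
def switchTypes (κ : Type*) [DecidableEq κ] [Fintype κ] : Finset (κ → ℤ) :=
  Finset.univ.image fun (x : κ × κ × κ × κ) i =>
    (if x.1 = i then 1 else 0) + (if x.2.1 = i then 1 else 0)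
      - (if x.2.2.1 = i then 1 else 0) - (if x.2.2.2 = i then 1 else 0)

theorem card_switchTypes_le [Fintype κ] : (switchTypes κ).card ≤ Fintype.card κ ^ 4 := by
  refine Finset.card_image_le.trans_eq ?_
  simp only [Finset.card_univ, Fintype.card_prod]
  ring

theorem switchChange_mem_switchTypes [Fintype κ] (σ : ι × Bool ≃ V) (j l : ι) (b : Bool) :
    switchChange c σ j l b ∈ switchTypes κ :=
  Finset.mem_image.mpr ⟨(c s(σ (j, false), σ (l, b)), c s(σ (j, true), σ (l, !b)),
    c (pairingEdge σ j), c (pairingEdge σ l)), Finset.mem_univ _, rfl⟩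

/-- A change is `K`-robust if no `K` edges of the matching meet all switches realizing it. -/
def RobustChange (σ : ι × Bool ≃ V) (K : ℕ) (τ : κ → ℤ) : Prop :=
  ∀ U : Finset ι, U.card ≤ K → ∃ j l b, j ≠ l ∧ j ∉ U ∧ l ∉ U ∧ switchChange c σ j l b = τ

theorem exists_colourCount_eq_add_sum [Fintype ι] [DecidableEq ι] (σ : ι × Bool ≃ V) {K : ℕ}
    (L : List (κ → ℤ)) (hL : ∀ τ ∈ L, RobustChange c σ K τ) (hK : 2 * L.length ≤ K + 2) :
    ∃ σ' : ι × Bool ≃ V, colourCount c σ' = colourCount c σ + L.sum := by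
  suffices ∃ (σ' : ι × Bool ≃ V) (U : Finset ι), U.card ≤ 2 * L.length ∧
      (∀ p ∉ U, ∀ b, σ' (p, b) = σ (p, b)) ∧ colourCount c σ' = colourCount c σ + L.sum from
    let ⟨σ', _, _, _, h⟩ := this
    ⟨σ', h⟩
  induction L with
  | nil => exact ⟨σ, ∅, by simp, by simp, by simp⟩
  | cons τ L ih =>
    simp only [List.length_cons] at hK
    obtain ⟨σ', U, hU, hσ', hsum⟩ := ih (fun t ht => hL t (List.mem_cons_of_mem _ ht)) (by omega)
    obtain ⟨j, l, b, hjl, hj, hl, hτ⟩ := hL τ List.mem_cons_self U (by omega)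
    refine ⟨switchPairing σ' j l b, insert j (insert l U), ?_, ?_, ?_⟩
    · have h1 := Finset.card_insert_le j (insert l U)
      have h2 := Finset.card_insert_le l U
      simp only [List.length_cons]
      omega
    · intro p hp b'
      simp only [Finset.mem_insert, not_or] at hp
      rw [switchPairing_apply_of_ne σ' b b' hp.1 hp.2.1, hσ' p hp.2.2]
    · have : switchChange c σ' j l b = τ := by
        rw [← hτ]
        ext i
        rw [switchChange, switchChange, pairingEdge, pairingEdge, pairingEdge, pairingEdge]
        rw [hσ' j hj, hσ' j hj, hσ' l hl, hσ' l hl, hσ' l hl, hσ' l hl]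
      rw [colourCount_switchPairing c σ' hjl, hsum, this, List.sum_cons]
      abel

theorem exists_colourCount_eq_add_sum_mul [Fintype ι] [DecidableEq ι] {α : Type*}
    (σ : ι × Bool ≃ V) {K m : ℕ}
    (J : Finset α) (v : α → κ → ℤ) (n : α → ℕ) (hv : ∀ p ∈ J, RobustChange c σ K (v p))
    (hn : ∑ p ∈ J, n p ≤ m) (hK : 2 * m ≤ K + 2) :
    ∃ σ' : ι × Bool ≃ V, ∀ i,
      colourCount c σ' i = colourCount c σ i + ∑ p ∈ J, (n p : ℤ) * v p i := by
  obtain ⟨σ', h⟩ := exists_colourCount_eq_add_sum c σ (K := K)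
    (J.toList.flatMap fun p => List.replicate (n p) (v p)) (by
      intro τ hτ
      obtain ⟨p, hp, hτ⟩ := List.mem_flatMap.mp hτ
      rw [List.eq_of_mem_replicate hτ]
      exact hv p (Finset.mem_toList.mp hp)) (by
      simp only [List.length_flatMap, List.length_replicate, Finset.sum_map_toList]
      omega)
  refine ⟨σ', fun i => ?_⟩
  rw [h, Pi.add_apply, List.flatMap_def, List.sum_flatten, List.map_map, Finset.sum_map_toList,
    Finset.sum_apply]
  simp

theorem exists_cover_of_not_robustChange [Fintype κ] [DecidableEq ι] (σ : ι × Bool ≃ V) (K : ℕ) :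
    ∃ H : Finset ι, H.card ≤ Fintype.card κ ^ 4 * K ∧ ∀ j l b, j ≠ l → j ∉ H → l ∉ H →
      RobustChange c σ K (switchChange c σ j l b) := by
  classical
  have h : ∀ τ : κ → ℤ, ∃ U : Finset ι, U.card ≤ K ∧ (¬ RobustChange c σ K τ →
      ∀ j l b, j ≠ l → j ∉ U → l ∉ U → switchChange c σ j l b ≠ τ) := by
    intro τ
    by_cases hτ : RobustChange c σ K τ
    · exact ⟨∅, by simp, fun h => absurd hτ h⟩
    · have hτ' := hτ
      unfold RobustChange at hτ'
      push Not at hτ'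
      obtain ⟨U, hU, h⟩ := hτ'
      exact ⟨U, hU, fun _ => h⟩
  choose U hU hU' using h
  refine ⟨(switchTypes κ).biUnion U, ?_, ?_⟩
  · exact (Finset.card_biUnion_le_card_mul _ _ K fun τ _ => hU τ).trans
      (Nat.mul_le_mul_right K card_switchTypes_le)
  · intro j l b hjl hj hl
    by_contra hrob
    have hmem := switchChange_mem_switchTypes c σ j l b
    simp only [Finset.mem_biUnion, not_exists, not_and] at hj hl
    exact hU' _ hrob j l b hjl (hj _ hmem) (hl _ hmem) rfl

/-- The pairs of distinct indices, together with a choice of a way to switch. -/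
def allSwitches (ι : Type*) [Fintype ι] [DecidableEq ι] : Finset (ι × ι × Bool) :=
  Finset.univ.filter fun p => p.1 ≠ p.2.1

theorem sum_allSwitches [Fintype ι] [DecidableEq ι] (F : ι × ι × Bool → ℤ) :
    ∑ p ∈ allSwitches ι, F p = ∑ j, ∑ l ∈ Finset.univ.erase j, ∑ b, F (j, l, b) := by
  rw [allSwitches, Finset.sum_filter, Fintype.sum_prod_type]
  refine Finset.sum_congr rfl fun j _ => ?_
  rw [Fintype.sum_prod_type, ← Finset.sum_erase Finset.univ (a := j)]
  · refine Finset.sum_congr rfl fun l hl => Finset.sum_congr rfl fun b _ => ?_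
    simp [(Finset.ne_of_mem_erase hl).symm]
  · simp

theorem sum_switchChange_allSwitches [Fintype ι] [DecidableEq ι] (σ : ι × Bool ≃ V) (i : κ) {D : ℤ}
    (hD : ∑ x : ι × Bool, ∑ y : ι × Bool,
      (if x ≠ y ∧ c s(σ x, σ y) = i then (1 : ℤ) else 0) = D) :
    ∑ p ∈ allSwitches ι, switchChange c σ p.1 p.2.1 p.2.2 i
      = D - 2 * (2 * Fintype.card ι - 1) * colourCount c σ i := by
  let F : ι × Bool → ι × Bool → ℤ := fun x y => if c s(σ x, σ y) = i then 1 else 0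
  let m : ι → ℤ := fun j => F (j, false) (j, true)
  have hm : ∀ j, F (j, true) (j, false) = m j := fun j => by simp [m, F, Sym2.eq_swap]
  have hcc : colourCount c σ i = ∑ j, m j := rfl
  have hD' : D = ∑ j, (∑ l ∈ Finset.univ.erase j, ∑ b, (F (j, false) (l, b) + F (j, true) (l, b))
      + 2 * m j) := by
    rw [← hD, Fintype.sum_prod_type]
    refine Finset.sum_congr rfl fun j _ => ?_
    rw [Fintype.sum_bool, Fintype.sum_prod_type, Fintype.sum_prod_type,
      ← Finset.sum_add_distrib, ← Finset.sum_erase_add _ _ (Finset.mem_univ j)]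
    congr 1
    · refine Finset.sum_congr rfl fun l hl => ?_
      have := (Finset.ne_of_mem_erase hl).symm
      simp only [Fintype.sum_bool, ne_eq, Prod.mk.injEq, this, false_and, not_false_eq_true,
        true_and, F]
      ring
    · have h := hm j
      simp only [F, m] at h ⊢
      simp only [Fintype.sum_bool, ne_eq, Prod.mk.injEq, true_and, not_true_eq_false, false_and,
        if_false, Bool.true_eq_false, Bool.false_eq_true, not_false_eq_true, h]
      ring
  have hN : ∀ j : ι, ((Finset.univ.erase j).card : ℤ) = Fintype.card ι - 1 := by
    intro j
    have : 0 < Fintype.card ι := Fintype.card_pos_iff.mpr ⟨j⟩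
    rw [Finset.card_erase_of_mem (Finset.mem_univ j), Finset.card_univ]
    omega
  have herase : ∀ j : ι, ∑ l ∈ Finset.univ.erase j, m l = colourCount c σ i - m j := by
    intro j
    rw [hcc, ← Finset.sum_erase_add _ _ (Finset.mem_univ j)]
    ring
  rw [sum_allSwitches]
  calc ∑ j, ∑ l ∈ Finset.univ.erase j, ∑ b, switchChange c σ j l b i
      = ∑ j, (∑ l ∈ Finset.univ.erase j, ∑ b, (F (j, false) (l, b) + F (j, true) (l, b))
          - ∑ l ∈ Finset.univ.erase j, (2 * m j + 2 * m l)) := by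
        refine Finset.sum_congr rfl fun j _ => ?_
        rw [← Finset.sum_sub_distrib]
        refine Finset.sum_congr rfl fun l _ => ?_
        simp only [Fintype.sum_bool]
        change F (j, false) (l, true) + F (j, true) (l, false) - m j - m l
          + (F (j, false) (l, false) + F (j, true) (l, true) - m j - m l) = _
        ring
    _ = _ := by
        simp only [Finset.sum_add_distrib, ← Finset.mul_sum, herase, Finset.sum_const, hN,
          nsmul_eq_mul, Finset.sum_sub_distrib, hD', ← hcc, Finset.card_univ]
        ring

theorem card_switches_meeting_le [Fintype ι] [DecidableEq ι] (H : Finset ι) :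
    ((((allSwitches ι).filter fun p => ¬ (p.1 ∉ H ∧ p.2.1 ∉ H)).card : ℕ) : ℤ)
      ≤ 4 * H.card * (Fintype.card ι - 1) := by
  have hN : ∀ j : ι, ((Finset.univ.erase j).card : ℤ) = Fintype.card ι - 1 := by
    intro j
    have : 0 < Fintype.card ι := Fintype.card_pos_iff.mpr ⟨j⟩
    rw [Finset.card_erase_of_mem (Finset.mem_univ j), Finset.card_univ]
    omega
  let χ : ι → ℤ := fun j => if j ∈ H then 1 else 0
  have hχ : ∑ j, χ j = H.card := by simp [χ]
  have herase : ∀ j : ι, ∑ l ∈ Finset.univ.erase j, χ l = H.card - χ j := by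
    intro j
    rw [← hχ, ← Finset.sum_erase_add _ _ (Finset.mem_univ j)]
    ring
  rw [Finset.card_filter]
  push_cast
  calc ∑ p ∈ allSwitches ι, (if ¬ (p.1 ∉ H ∧ p.2.1 ∉ H) then (1 : ℤ) else 0)
      ≤ ∑ p ∈ allSwitches ι, (χ p.1 + χ p.2.1) := by
        refine Finset.sum_le_sum fun p _ => ?_
        by_cases h1 : p.1 ∈ H <;> by_cases h2 : p.2.1 ∈ H <;> simp [χ, h1, h2]
    _ = 4 * H.card * (Fintype.card ι - 1) := by
        rw [sum_allSwitches]
        simp only [Finset.sum_add_distrib, herase, Finset.sum_const, hN,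
          nsmul_eq_mul, Finset.sum_sub_distrib, ← Finset.mul_sum, hχ, Finset.card_univ,
          Fintype.card_bool]
        push_cast
        ring

end Pairing

theorem sum_colourCount_sub {ι V : Type*} [Fintype ι] {n k : ℕ} (hN : Fintype.card ι = n * k)
    (c : Sym2 V → Fin k) (σ : ι × Bool ≃ V) : ∑ i, (colourCount c σ i - n) = 0 := by
  rw [Finset.sum_sub_distrib, sum_colourCount, hN]
  simp [mul_comm]

theorem two_mul_error_le_four_pow_sq {r : ℕ} (hr : 2 ≤ r) :
    192 * (r + 1) ^ 4 * r ^ 2 * 4 ^ (r - 1) ≤ 4 ^ ((r + 1) ^ 2) := by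
  induction r, hr using Nat.le_induction with
  | base => norm_num
  | succ r hr ih =>
    calc 192 * (r + 1 + 1) ^ 4 * (r + 1) ^ 2 * 4 ^ (r + 1 - 1)
        ≤ 192 * (2 * (r + 1)) ^ 4 * (2 * r) ^ 2 * 4 ^ (r - 1 + 1) := by
          gcongr <;> omega
      _ = 192 * (r + 1) ^ 4 * r ^ 2 * 4 ^ (r - 1) * 4 ^ 4 := by ring
      _ ≤ 4 ^ ((r + 1) ^ 2) * 4 ^ (2 * r + 3) := by
          gcongr <;> omega
      _ = 4 ^ ((r + 1 + 1) ^ 2) := by rw [← pow_add]; congr 1; ring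

section Descent

variable {ι V : Type*} [Fintype ι] [DecidableEq ι] {n k : ℕ}

theorem exists_better_pairing_of_two_colours (c : Sym2 V → Fin 2) (σ : ι × Bool ≃ V)
    (hι : 0 < Fintype.card ι) (hN : Fintype.card ι = n * 2)
    (hdrift : ∀ i, ∑ p ∈ allSwitches ι, switchChange c σ p.1 p.2.1 p.2.2 i
      = -(2 * (2 * Fintype.card ι - 1)) * (colourCount c σ i - n))
    (hlarge : 4 < ∑ i, |colourCount c σ i - n|) :
    ∃ σ' : ι × Bool ≃ V, ∑ i, |colourCount c σ' i - n| < ∑ i, |colourCount c σ i - n| := by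
  have hsum : ∀ σ : ι × Bool ≃ V,
      ∑ i, |colourCount c σ i - n| = 2 * |colourCount c σ 0 - n| := by
    intro σ
    have := sum_colourCount_sub hN c σ
    rw [Fin.sum_univ_two] at this ⊢
    rw [show colourCount c σ 1 - n = -(colourCount c σ 0 - n) by linarith, abs_neg]
    ring
  simp only [hsum] at hlarge ⊢
  set w := colourCount c σ 0 - n with hw
  have hw0 : w ≠ 0 := by rintro h; simp [h] at hlarge
  obtain ⟨p, hp, hneg⟩ : ∃ p ∈ allSwitches ι, switchChange c σ p.1 p.2.1 p.2.2 0 * w < 0 := by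
    by_contra! h
    have h1 := Finset.sum_nonneg h
    rw [← Finset.sum_mul, hdrift 0, ← hw] at h1
    have : 0 < w ^ 2 := by positivity
    have hι' : (1 : ℤ) ≤ Fintype.card ι := by exact_mod_cast hι
    nlinarith
  refine ⟨switchPairing σ p.1 p.2.1 p.2.2, ?_⟩
  rw [colourCount_switchPairing c σ (by simpa [allSwitches] using hp), Pi.add_apply]
  have h2 := abs_switchChange_le_two c σ p.1 p.2.1 p.2.2 0
  set d := switchChange c σ p.1 p.2.1 p.2.2 0
  rw [show colourCount c σ 0 + d - n = w + d by rw [hw]; ring]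
  rw [abs_le] at h2
  rcases lt_or_gt_of_ne hw0 with h | h
  · have hd : 0 < d := by by_contra! h'; nlinarith
    rw [abs_of_neg h] at hlarge ⊢
    rw [abs_of_neg (by linarith)]
    linarith
  · have hd : d < 0 := by by_contra! h'; nlinarith
    rw [abs_of_pos h] at hlarge ⊢
    rw [abs_of_pos (by linarith)]
    linarith

theorem exists_better_pairing_of_three_le (hk : 3 ≤ k) (c : Sym2 V → Fin k) (σ : ι × Bool ≃ V)
    (hι : 0 < Fintype.card ι)
    (hdrift : ∀ i, ∑ p ∈ allSwitches ι, switchChange c σ p.1 p.2.1 p.2.2 i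
      = -(2 * (2 * Fintype.card ι - 1)) * (colourCount c σ i - n))
    (hlarge : 4 ^ (k ^ 2) < ∑ i, |colourCount c σ i - n|) :
    ∃ σ' : ι × Bool ≃ V, ∑ i, |colourCount c σ' i - n| < ∑ i, |colourCount c σ i - n| := by
  obtain ⟨r, rfl⟩ : ∃ r, k = r + 1 := ⟨k - 1, by omega⟩
  obtain ⟨m, hm⟩ : ∃ m, m = 12 * r ^ 2 * 4 ^ (r - 1) := ⟨_, rfl⟩
  obtain ⟨H, hH, hrob⟩ := exists_cover_of_not_robustChange c σ (2 * m)
  rw [Fintype.card_fin] at hH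
  let w : Fin (r + 1) → ℤ := fun i => colourCount c σ i - n
  let δ : ι × ι × Bool → Fin (r + 1) → ℤ := fun p => switchChange c σ p.1 p.2.1 p.2.2
  have hδ : ∀ p, ∑ i, |(δ p i : ℝ)| ≤ 4 := fun p => by
    exact_mod_cast sum_abs_switchChange_le c σ p.1 p.2.1 p.2.2
  let s := (allSwitches ι).filter fun p => p.1 ∉ H ∧ p.2.1 ∉ H
  let t := (allSwitches ι).filter fun p => ¬ (p.1 ∉ H ∧ p.2.1 ∉ H)
  have hι' : (1 : ℝ) ≤ Fintype.card ι := by exact_mod_cast hι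
  let q : ℝ := 2 * (2 * Fintype.card ι - 1)
  have hq : 0 < q := by simp only [q]; linarith
  have hsplit : ∀ i, ∑ p ∈ s, q⁻¹ * (δ p i : ℝ) + w i = -(q⁻¹ * ∑ p ∈ t, (δ p i : ℝ)) := by
    intro i
    have h1 : ∑ p ∈ s, (δ p i : ℝ) + ∑ p ∈ t, (δ p i : ℝ) = -q * w i := by
      rw [Finset.sum_filter_add_sum_filter_not]
      have h2 := congrArg (Int.cast : ℤ → ℝ) (hdrift i)
      push_cast at h2
      simpa only [w, q, δ, Int.cast_sub, Int.cast_natCast] using h2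
    rw [← Finset.mul_sum, eq_sub_of_add_eq h1]
    field_simp
    ring
  have ht : (t.card : ℝ) ≤ 4 * H.card * (Fintype.card ι - 1) := by
    exact_mod_cast card_switches_meeting_le H
  have hE : ∑ i, |∑ p ∈ s, q⁻¹ * (δ p i : ℝ) + w i| ≤ ((8 * (r + 1) ^ 4 * m : ℕ) : ℝ) := by
    calc ∑ i, |∑ p ∈ s, q⁻¹ * (δ p i : ℝ) + w i|
        ≤ ∑ i, q⁻¹ * ∑ p ∈ t, |(δ p i : ℝ)| := by
          refine Finset.sum_le_sum fun i _ => ?_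
          rw [hsplit, abs_neg, abs_mul, abs_of_pos (inv_pos.mpr hq)]
          gcongr
          exact Finset.abs_sum_le_sum_abs _ _
      _ = q⁻¹ * ∑ p ∈ t, ∑ i, |(δ p i : ℝ)| := by
          rw [← Finset.mul_sum, Finset.sum_comm]
      _ ≤ q⁻¹ * (4 * t.card) := by
          gcongr
          refine (Finset.sum_le_sum fun p _ => hδ p).trans_eq ?_
          rw [Finset.sum_const, nsmul_eq_mul, mul_comm]
      _ ≤ 4 * H.card := by
          rw [inv_mul_le_iff₀ hq]
          simp only [q]
          nlinarith [Nat.cast_nonneg (α := ℝ) H.card]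
      _ ≤ 4 * ((r + 1) ^ 4 * (2 * m) : ℕ) := by gcongr
      _ = ((8 * (r + 1) ^ 4 * m : ℕ) : ℝ) := by push_cast; ring
  have hrE : 4 * (r : ℝ) ≤ ((8 * (r + 1) ^ 4 * m : ℕ) : ℝ) := by
    have h1 : r ≤ m := by
      rw [hm]
      nlinarith [Nat.one_le_pow (r - 1) 4 (by norm_num), Nat.le_self_pow two_ne_zero r]
    have h2 : 1 ≤ (r + 1) ^ 4 := Nat.one_le_pow _ _ (by omega)
    have : 4 * r ≤ 8 * (r + 1) ^ 4 * m := by nlinarith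
    exact_mod_cast this
  have hw : 2 * ((8 * (r + 1) ^ 4 * m : ℕ) : ℝ) < ∑ i, |(w i : ℝ)| := by
    have h1 : 2 * (8 * (r + 1) ^ 4 * m) ≤ 4 ^ ((r + 1) ^ 2) := by
      refine le_trans (le_of_eq ?_) (two_mul_error_le_four_pow_sq (r := r) (by omega))
      rw [hm]
      ring
    calc 2 * ((8 * (r + 1) ^ 4 * m : ℕ) : ℝ) ≤ ((4 ^ ((r + 1) ^ 2) : ℕ) : ℝ) := by
          exact_mod_cast h1
      _ < ∑ i, |(w i : ℝ)| := by exact_mod_cast hlarge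
  obtain ⟨J, hJ, x, hx, hlt⟩ := exists_nat_combination_sum_abs_lt δ s (fun p _ => hδ p)
    (fun p _ => sum_switchChange c σ p.1 p.2.1 p.2.2) w (fun _ => q⁻¹)
    (fun _ _ => (inv_pos.mpr hq).le) hE (by omega) (Fintype.card_fin _) hm hrE hw
  obtain ⟨σ', hσ'⟩ := exists_colourCount_eq_add_sum_mul c σ (K := 2 * m) J δ x (by
    intro p hp
    have hps := hJ hp
    simp only [s, allSwitches, Finset.mem_filter, Finset.mem_univ, true_and] at hps
    exact hrob _ _ _ hps.1 hps.2.1 hps.2.2) hx (by omega)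
  refine ⟨σ', lt_of_eq_of_lt (Finset.sum_congr rfl fun i _ => ?_) hlt⟩
  rw [hσ']
  simp only [w]
  ring_nf

theorem exists_pairing_sum_abs_le (hn : 0 < n) (hk : 0 < k) (c : Sym2 V → Fin k)
    (hN : Fintype.card ι = n * k) (e : ι × Bool ≃ V)
    (hc : ∀ (σ : ι × Bool ≃ V) i, ∑ x : ι × Bool, ∑ y : ι × Bool,
      (if x ≠ y ∧ c s(σ x, σ y) = i then (1 : ℤ) else 0) = 2 * (n * (2 * (n * k) - 1))) :
    ∃ σ : ι × Bool ≃ V, ∑ i, |colourCount c σ i - n| ≤ 4 ^ (k ^ 2) := by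
  have : Fintype V := Fintype.ofEquiv _ e
  have : DecidableEq V := Classical.decEq V
  have : Nonempty (ι × Bool ≃ V) := ⟨e⟩
  obtain ⟨σ, hσ⟩ := Finite.exists_min fun σ : ι × Bool ≃ V => ∑ i, |colourCount c σ i - n|
  refine ⟨σ, ?_⟩
  by_contra! hlarge
  have hι : 0 < Fintype.card ι := by rw [hN]; positivity
  have hdrift : ∀ i, ∑ p ∈ allSwitches ι, switchChange c σ p.1 p.2.1 p.2.2 i
      = -(2 * (2 * Fintype.card ι - 1)) * (colourCount c σ i - n) := by
    intro i
    rw [sum_switchChange_allSwitches c σ i (hc σ i), hN]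
    push_cast
    ring
  have hk' : k = 1 ∨ k = 2 ∨ 3 ≤ k := by omega
  obtain ⟨σ', hσ'⟩ : ∃ σ' : ι × Bool ≃ V,
      ∑ i, |colourCount c σ' i - n| < ∑ i, |colourCount c σ i - n| := by
    rcases hk' with rfl | rfl | hk
    · have := sum_colourCount_sub hN c σ
      rw [Fin.sum_univ_one] at this hlarge
      simp [this] at hlarge
    · exact exists_better_pairing_of_two_colours c σ hι hN hdrift
        (lt_trans (by norm_num) hlarge)
    · exact exists_better_pairing_of_three_le hk c σ hι hdrift hlarge
  exact (hσ σ').not_gt hσ'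

end Descent

theorem sum_sum_ite_colour_eq {V κ : Type*} [Fintype V] [DecidableEq V] [DecidableEq κ]
    (c : Sym2 V → κ) (i : κ) :
    ∑ x, ∑ y, (if x ≠ y ∧ c s(x, y) = i then (1 : ℤ) else 0)
      = 2 * (((⊤ : SimpleGraph V).edgeSet ∩ {e | c e = i}).ncard : ℤ) := by
  let G := SimpleGraph.fromEdgeSet {e : Sym2 V | c e = i}
  have hG : G.edgeSet = (⊤ : SimpleGraph V).edgeSet ∩ {e | c e = i} := by
    ext e
    induction e with
    | h x y => simp [G, and_comm]
  have hcard : ((⊤ : SimpleGraph V).edgeSet ∩ {e | c e = i}).ncard = G.edgeFinset.card := by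
    rw [← hG, ← SimpleGraph.coe_edgeFinset, Set.ncard_coe_finset]
  have h := G.sum_degrees_eq_twice_card_edges
  rw [hcard]
  have h' : (∑ x, (G.degree x : ℤ)) = 2 * (G.edgeFinset.card : ℤ) := by
    rw [← Nat.cast_sum, h]
    push_cast
    congr!
  rw [← h']
  refine Finset.sum_congr rfl fun x _ => ?_
  rw [← SimpleGraph.card_neighborFinset_eq_degree, SimpleGraph.neighborFinset_eq_filter,
    Finset.card_filter]
  push_cast
  refine Finset.sum_congr rfl fun y _ => ?_
  simp [G, and_comm]

/-- The perfect matching of the complete graph given by a bijection. -/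
def pairingSubgraph {ι V : Type*} (σ : ι × Bool ≃ V) : (⊤ : SimpleGraph V).Subgraph where
  verts := Set.univ
  Adj x y := ∃ j, s(x, y) = pairingEdge σ j
  adj_sub := by
    rintro x y ⟨j, hj⟩
    rw [SimpleGraph.top_adj]
    rintro rfl
    have : σ (j, false) = σ (j, true) := by
      simp only [pairingEdge, Sym2.eq_iff] at hj
      grind
    simpa using σ.injective this
  edge_vert _ := Set.mem_univ _
  symm := ⟨by
    rintro x y ⟨j, hj⟩
    exact ⟨j, by rw [Sym2.eq_swap, hj]⟩⟩

theorem pairingEdge_eq {ι V : Type*} (σ : ι × Bool ≃ V) (j : ι) (b : Bool) :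
    pairingEdge σ j = s(σ (j, b), σ (j, !b)) := by
  cases b
  · rfl
  · exact Sym2.eq_swap

theorem eq_of_mk_apply_eq_pairingEdge {ι V : Type*} (σ : ι × Bool ≃ V) {j l : ι} {b : Bool} {y : V}
    (h : s(σ (j, b), y) = pairingEdge σ l) : l = j ∧ y = σ (j, !b) := by
  rw [pairingEdge, Sym2.eq_iff] at h
  rcases h with ⟨h1, h2⟩ | ⟨h1, h2⟩ <;>
  · have := σ.injective h1
    simp only [Prod.mk.injEq] at this
    obtain ⟨rfl, rfl⟩ := this
    exact ⟨rfl, h2⟩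

theorem isPerfectMatching_pairingSubgraph {ι V : Type*} (σ : ι × Bool ≃ V) :
    (pairingSubgraph σ).IsPerfectMatching := by
  refine ⟨fun x _ => ?_, fun x => Set.mem_univ x⟩
  obtain ⟨⟨j, b⟩, rfl⟩ := σ.surjective x
  refine ⟨σ (j, !b), ⟨j, (pairingEdge_eq σ j b).symm⟩, ?_⟩
  rintro y ⟨l, hl⟩
  exact (eq_of_mk_apply_eq_pairingEdge σ hl).2

theorem pairingEdge_injective {ι V : Type*} (σ : ι × Bool ≃ V) :
    Function.Injective (pairingEdge σ) := fun _ _ h =>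
  (eq_of_mk_apply_eq_pairingEdge σ h.symm).1

theorem ncard_edgeSet_pairingSubgraph {ι V κ : Type*} [Fintype ι] [DecidableEq κ]
    (c : Sym2 V → κ) (σ : ι × Bool ≃ V) (i : κ) :
    (((pairingSubgraph σ).edgeSet ∩ {e | c e = i}).ncard : ℤ) = colourCount c σ i := by
  have h : (pairingSubgraph σ).edgeSet ∩ {e | c e = i}
      = pairingEdge σ '' {j | c (pairingEdge σ j) = i} := by
    ext e
    induction e with
    | h x y =>
      simp only [Set.mem_inter_iff, SimpleGraph.Subgraph.mem_edgeSet, Set.mem_ofPred_eq,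
        Set.mem_image]
      constructor
      · rintro ⟨⟨j, hj⟩, hi⟩
        exact ⟨j, hj ▸ hi, hj.symm⟩
      · rintro ⟨j, hi, hj⟩
        exact ⟨⟨j, hj.symm⟩, hj ▸ hi⟩
  rw [h, Set.ncard_image_of_injective _ (pairingEdge_injective σ), colourCount,
    Finset.sum_boole, ← Set.ncard_coe_finset]
  simp

/-- For all positive integers `n` and `k`, and every colour-balanced
edge-colouring `c : E(K_{2nk}) → {1,…,k}`, there exists a perfect matching `M` of `K_{2nk}`
with `f(M) ≤ 4^(k²)`, where `f(M) = ∑ᵢ |mᵢ(M) − n|`. -/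
theorem almost_balanced_matching_uniform_bound
    (n k : ℕ) (hn : 0 < n) (hk : 0 < k)
    (c : Sym2 (Fin (2 * n * k)) → Fin k)
    (hc : ∀ i : Fin k,
      (((⊤ : SimpleGraph (Fin (2 * n * k))).edgeSet ∩ {e | c e = i}).ncard
        = (2 * n * k).choose 2 / k)) :
    ∃ M : (⊤ : SimpleGraph (Fin (2 * n * k))).Subgraph, M.IsPerfectMatching ∧
      ∑ i : Fin k, |((M.edgeSet ∩ {e | c e = i}).ncard : ℤ) - (n : ℤ)| ≤ 4 ^ (k ^ 2) := by
  have hN : 0 < n * k := Nat.mul_pos hn hk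
  have hcV : Fintype.card (Fin (n * k) × Bool) = Fintype.card (Fin (2 * n * k)) := by
    simp only [Fintype.card_prod, Fintype.card_fin, Fintype.card_bool]
    ring
  have hcount : ∀ (σ : Fin (n * k) × Bool ≃ Fin (2 * n * k)) (i : Fin k),
      ∑ x : Fin (n * k) × Bool, ∑ y : Fin (n * k) × Bool,
        (if x ≠ y ∧ c s(σ x, σ y) = i then (1 : ℤ) else 0) = 2 * (n * (2 * (n * k) - 1)) := by
    intro σ i
    have hchoose : (2 * n * k).choose 2 / k = n * (2 * (n * k) - 1) := by
      rw [Nat.choose_two_right,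
        show 2 * n * k * (2 * n * k - 1) = 2 * (k * (n * (2 * n * k - 1))) by ring,
        Nat.mul_div_cancel_left _ two_pos, Nat.mul_div_cancel_left _ hk, mul_assoc]
    have h := sum_sum_ite_colour_eq c i
    rw [hc i, hchoose] at h
    push_cast [Nat.cast_sub (show 1 ≤ 2 * (n * k) by omega)] at h
    rw [← h, ← σ.sum_comp]
    refine Finset.sum_congr rfl fun x _ => ?_
    rw [← σ.sum_comp]
    simp only [ne_eq, σ.injective.eq_iff]
  obtain ⟨σ, hσ⟩ := exists_pairing_sum_abs_le hn hk c (Fintype.card_fin _)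
    (Fintype.equivOfCardEq hcV) hcount
  refine ⟨pairingSubgraph σ, isPerfectMatching_pairingSubgraph σ, ?_⟩
  simpa only [ncard_edgeSet_pairingSubgraph] using hσ
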